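/- Let n ≥ 2 and let M be an integer with 2^(n−1) < M < 2^n, and let F be the set of positions l < n at which the binary expansion of M has a one. Suppose ν : ℕ → ℕ assigns to each l ∈ F a value ν l with l ≤ ν l ≤ n − 1. Then (n−2) * M ≤ ∑_{l ∈ F} ν l * 2^l ≤ (n−1) * M. -/

import Mathlib

theorem sum_two_pow_testBit_eq_mod (M n : ℕ) :
    ∑ l ∈ (Finset.range n).filter (fun l => M.testBit l), 2 ^ l = M % 2 ^ n := by
  induction n with
  | zero => simp [Nat.mod_one]
  | succ n ih =>
    rw [Finset.sum_filter] at ih ⊢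
    rw [Finset.sum_range_succ, ih, Nat.mod_pow_succ, ← Nat.toNat_testBit]
    cases M.testBit n <;> simp

theorem sum_range_sub_mul_two_pow (k : ℕ) :
    ∑ l ∈ Finset.range (k + 1), (k - l) * 2 ^ l + (k + 2) = 2 ^ (k + 1) := by
  induction k with
  | zero => simp
  | succ k ih =>
    have h : ∑ l ∈ Finset.range (k + 1), (k + 1 - (l + 1)) * 2 ^ (l + 1) =
        2 * ∑ l ∈ Finset.range (k + 1), (k - l) * 2 ^ l := by
      rw [Finset.mul_sum]
      refine Finset.sum_congr rfl fun l _ => ?_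
      rw [Nat.add_sub_add_right]
      ring
    rw [Finset.sum_range_succ', h, pow_succ 2 (k + 1), ← ih]
    simp only [Nat.sub_zero, pow_zero]
    ring

/-- Corollary 8 of the paper: for `2^(n-1) < M < 2^n`, with `F` the set of
set-bit positions of `M` and `ν l` satisfying `l ≤ ν l ≤ n-1` on `F`, the
joint spectrum distance of the QUP punctured code satisfies
`n-2 ≤ (1/M) ∑_{l ∈ F} ν l * 2^l ≤ n-1`. -/
theorem qup_jsd_bounds (n M : ℕ) (hn : 2 ≤ n) (h1 : 2 ^ (n - 1) < M)
    (h2 : M < 2 ^ n) (F : Finset ℕ)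
    (hF : F = (Finset.range n).filter fun l => M.testBit l)
    (ν : ℕ → ℕ) (hν : ∀ l ∈ F, l ≤ ν l ∧ ν l ≤ n - 1) :
    (n - 2) * M ≤ ∑ l ∈ F, ν l * 2 ^ l ∧
      ∑ l ∈ F, ν l * 2 ^ l ≤ (n - 1) * M := by
  have hM : ∑ l ∈ F, 2 ^ l = M := by
    rw [hF, sum_two_pow_testBit_eq_mod, Nat.mod_eq_of_lt h2]
  refine ⟨?_, ?_⟩
  · obtain ⟨k, rfl⟩ := Nat.exists_eq_add_of_le' hn
    simp only [Nat.add_sub_cancel, show k + 2 - 1 = k + 1 from rfl] at *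
    have top : M.testBit (k + 1) = true := Nat.testBit_of_two_pow_le_and_two_pow_add_one_gt h1.le h2
    have hk : ν (k + 1) = k + 1 := by
      have := hν (k + 1) (by simp [hF, top])
      omega
    have low : ∑ l ∈ Finset.range (k + 1), (if M.testBit l then k * 2 ^ l else 0) ≤
        ∑ l ∈ Finset.range (k + 1), (if M.testBit l then ν l * 2 ^ l else 0) +
          ∑ l ∈ Finset.range (k + 1), (k - l) * 2 ^ l := by
      rw [← Finset.sum_add_distrib]
      refine Finset.sum_le_sum fun l hl => ?_
      split_ifs with hb
      · have hl' := Finset.mem_range.1 hl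
        have := hν l (by simp [hF, hb]; omega)
        rw [← add_mul]
        exact Nat.mul_le_mul_right _ (by omega)
      · exact Nat.zero_le _
    have deficit := sum_range_sub_mul_two_pow k
    rw [← hM, Finset.mul_sum, hF, Finset.sum_filter, Finset.sum_filter,
      Finset.sum_range_succ _ (k + 1), Finset.sum_range_succ _ (k + 1), if_pos top, if_pos top,
      hk, add_mul, one_mul]
    omega
  · rw [← hM, Finset.mul_sum]
    exact Finset.sum_le_sum fun l hl => Nat.mul_le_mul_right _ (hν l hl).2
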